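/- arXiv:1104.1280 — 8 statements merged into one kernel-verified Lean document; each statement's English description precedes it below -/
import Mathlib

section
/- For the Lévy–Khintchine Laplace exponent ψ associated with (μ, σ, Π), one has lim_{λ→∞} ψ(λ)/λ² = σ²/2. -/
open MeasureTheory Real Set Filter

/-- The compensated exponential integrand of the Lévy–Khintchine formula. -/
noncomputable def levyIntegrand (l x : ℝ) : ℝ :=
  Real.exp (l * x) - 1 - l * x * Set.indicator (Set.Ioo (-1 : ℝ) 0) (fun _ => (1 : ℝ)) x

lemma measurable_levyIntegrand (l : ℝ) : Measurable (levyIntegrand l) := by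
  unfold levyIntegrand
  have : Measurable (Set.indicator (Set.Ioo (-1 : ℝ) 0) (fun _ => (1 : ℝ))) :=
    measurable_const.indicator measurableSet_Ioo
  fun_prop

lemma abs_exp_sub_one_le_one {t : ℝ} (ht : t ≤ 0) : |Real.exp t - 1| ≤ 1 := by
  have h₁ := Real.exp_pos t
  have h₂ := Real.exp_le_one_iff.mpr ht
  rw [abs_le]
  constructor <;> linarith

lemma abs_exp_sub_one_sub_le_sq {t : ℝ} (ht : t ≤ 0) : |Real.exp t - 1 - t| ≤ t ^ 2 := by
  rcases le_or_gt (-1) t with h | h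
  · exact Real.abs_exp_sub_one_sub_id_le (abs_le.mpr ⟨h, by linarith⟩)
  · have h₁ := Real.add_one_le_exp t
    have h₂ := Real.exp_le_one_iff.mpr ht
    rw [abs_le]
    constructor <;> nlinarith

lemma abs_levyIntegrand_le_sq_mul_min {l x : ℝ} (hl : 1 ≤ l) (hx : x < 0) :
    |levyIntegrand l x| ≤ l ^ 2 * min 1 (x ^ 2) := by
  have hlx : l * x ≤ 0 := mul_nonpos_of_nonneg_of_nonpos (by linarith) hx.le
  by_cases h : -1 < x
  · have hmin : min 1 (x ^ 2) = x ^ 2 := min_eq_right (by nlinarith)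
    rw [levyIntegrand, Set.indicator_of_mem (Set.mem_Ioo.mpr ⟨h, hx⟩), mul_one, hmin, ← mul_pow]
    exact abs_exp_sub_one_sub_le_sq hlx
  · have hmin : min 1 (x ^ 2) = 1 := min_eq_left (by nlinarith)
    rw [levyIntegrand, Set.indicator_of_notMem (fun hm => h hm.1), mul_zero, sub_zero, hmin]
    exact (abs_exp_sub_one_le_one hlx).trans (by nlinarith)

lemma abs_levyIntegrand_le_mul {l x : ℝ} (hl : 1 ≤ l) (hx : x < 0) :
    |levyIntegrand l x| ≤ l * (1 + |x|) := by
  have hexp := abs_exp_sub_one_le_one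
    (mul_nonpos_of_nonneg_of_nonpos (zero_le_one.trans hl) hx.le)
  have hind : |Set.indicator (Set.Ioo (-1 : ℝ) 0) (fun _ => (1 : ℝ)) x| ≤ 1 := by
    by_cases h : x ∈ Set.Ioo (-1 : ℝ) 0 <;> simp [h]
  calc |levyIntegrand l x|
      ≤ |Real.exp (l * x) - 1| +
          |l * x * Set.indicator (Set.Ioo (-1 : ℝ) 0) (fun _ => (1 : ℝ)) x| := abs_sub _ _
    _ ≤ 1 + l * |x| := by
        rw [abs_mul, abs_mul, abs_of_nonneg (zero_le_one.trans hl)]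
        exact add_le_add hexp (mul_le_of_le_one_right (by positivity) hind)
    _ ≤ l * (1 + |x|) := by linarith

lemma tendsto_levyIntegrand_div_sq {x : ℝ} (hx : x < 0) :
    Tendsto (fun l : ℝ => levyIntegrand l x / l ^ 2) atTop (nhds 0) := by
  refine squeeze_zero_norm' ?_ ((tendsto_const_nhds (x := 1 + |x|)).div_atTop tendsto_id)
  filter_upwards [eventually_ge_atTop (1 : ℝ)] with l hl
  have hl₀ : 0 < l := by linarith
  rw [Real.norm_eq_abs, abs_div, abs_of_pos (pow_pos hl₀ 2), id,
    div_le_div_iff₀ (by positivity) hl₀]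
  calc |levyIntegrand l x| * l ≤ l * (1 + |x|) * l := by
        gcongr
        exact abs_levyIntegrand_le_mul hl hx
    _ = (1 + |x|) * l ^ 2 := by ring

lemma tendsto_integral_levyIntegrand_div_sq {Λ : Measure ℝ}
    (hint : ∫⁻ x, ENNReal.ofReal (min 1 (x ^ 2)) ∂Λ < ⊤) :
    Tendsto (fun l : ℝ => (∫ x in Set.Iio 0, levyIntegrand l x ∂Λ) / l ^ 2) atTop (nhds 0) := by
  have hbound : Integrable (fun x : ℝ => min 1 (x ^ 2)) Λ := by
    refine ⟨by fun_prop, ?_⟩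
    rwa [hasFiniteIntegral_iff_ofReal (ae_of_all _ fun x => by positivity)]
  simp_rw [← integral_div]
  suffices h : Tendsto (fun l : ℝ => ∫ x in Set.Iio 0, levyIntegrand l x / l ^ 2 ∂Λ) atTop
      (nhds (∫ _ in Set.Iio 0, 0 ∂Λ)) by
    rwa [integral_zero] at h
  refine tendsto_integral_filter_of_dominated_convergence
    (fun x : ℝ => min 1 (x ^ 2)) ?_ ?_ hbound.restrict ?_
  · exact Eventually.of_forall fun l =>
      ((measurable_levyIntegrand l).div_const _).aestronglyMeasurable
  · filter_upwards [eventually_ge_atTop (1 : ℝ)] with l hl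
    filter_upwards [ae_restrict_mem measurableSet_Iio] with x hx
    rw [Real.norm_eq_abs, abs_div, abs_of_nonneg (sq_nonneg l), div_le_iff₀' (by positivity)]
    exact abs_levyIntegrand_le_sq_mul_min hl hx
  · filter_upwards [ae_restrict_mem measurableSet_Iio] with x hx
    exact tendsto_levyIntegrand_div_sq hx

/-- For the Lévy–Khintchine Laplace exponent `ψ` associated with `(μ, σ, Λ)`, one has
`lim_{λ → ∞} ψ(λ)/λ² = σ²/2`. -/
theorem levy_khintchine_exponent_asymptotics
    (μ σ : ℝ) (Λ : Measure ℝ)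
    (hcarrier : Λ (Set.Ici 0) = 0)
    (hint : ∫⁻ x, ENNReal.ofReal (min 1 (x ^ 2)) ∂Λ < ⊤) :
    Tendsto
      (fun l : ℝ =>
        (-μ * l + σ ^ 2 / 2 * l ^ 2 +
          ∫ x in Set.Iio 0,
            (Real.exp (l * x) - 1 -
              l * x * Set.indicator (Set.Ioo (-1 : ℝ) 0) (fun _ => (1 : ℝ)) x) ∂Λ) / l ^ 2)
      atTop (nhds (σ ^ 2 / 2)) := by
  have hdrift : Tendsto (fun l : ℝ => -μ / l) atTop (nhds 0) :=
    tendsto_const_nhds.div_atTop tendsto_id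
  have hsum := (hdrift.add_const (σ ^ 2 / 2)).add (tendsto_integral_levyIntegrand_div_sq hint)
  rw [zero_add, add_zero] at hsum
  refine hsum.congr' ?_
  filter_upwards [eventually_gt_atTop (0 : ℝ)] with l hl
  simp only [levyIntegrand]
  field_simp
end

section
/- Assume additionally that ∫_{(−∞,−1]} |x| Π(dx) < ∞, and set κ = −μ + ∫_{(−∞,−1]} x Π(dx) (the value of ψ′(0+)). Then the spatial Wiener–Hopf factorization ψ(θ) = θ·φ(θ) holds for all θ ≥ 0, where φ(θ) = κ + (σ²/2)θ + ∫₀^∞ (1 − e^{−θu}) Π((−∞,−u)) du; in particular the integral ∫₀^∞ (1 − e^{−θu}) Π((−∞,−u)) du is finite for every θ ≥ 0. -/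
open MeasureTheory Real Set Filter

theorem integral_one_sub_exp_neg_mul (θ t : ℝ) :
    θ * ∫ u in (0 : ℝ)..t, (1 - exp (-θ * u)) = θ * t + exp (-θ * t) - 1 := by
  have hderiv : ∀ u ∈ uIcc 0 t, HasDerivAt (fun v : ℝ => θ * v + exp (-θ * v))
      (θ * (1 - exp (-θ * u))) u := fun u _ => by
    have h := ((hasDerivAt_id u).const_mul θ).add (((hasDerivAt_id u).const_mul (-θ)).exp)
    exact h.congr_deriv (by simp only [id]; ring)
  rw [← intervalIntegral.integral_const_mul,
    intervalIntegral.integral_eq_sub_of_hasDerivAt hderiv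
      (Continuous.intervalIntegrable (by fun_prop) _ _)]
  simp

theorem one_sub_exp_neg_mul_nonneg {θ u : ℝ} (hθ : 0 ≤ θ) (hu : 0 ≤ u) :
    0 ≤ 1 - exp (-θ * u) := by
  have : exp (-θ * u) ≤ 1 := exp_le_one_iff.2 (by nlinarith [mul_nonneg hθ hu])
  linarith

theorem integral_one_sub_exp_neg_mul_nonneg {θ t : ℝ} (hθ : 0 ≤ θ) (ht : 0 ≤ t) :
    0 ≤ ∫ u in (0 : ℝ)..t, (1 - exp (-θ * u)) :=
  intervalIntegral.integral_nonneg ht fun _ hu => one_sub_exp_neg_mul_nonneg hθ hu.1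

theorem integral_one_sub_exp_neg_mul_le_self {θ t : ℝ} (ht : 0 ≤ t) :
    ∫ u in (0 : ℝ)..t, (1 - exp (-θ * u)) ≤ t := by
  have h : ∫ u in (0 : ℝ)..t, (1 - exp (-θ * u)) ≤ ∫ _ in (0 : ℝ)..t, (1 : ℝ) :=
    intervalIntegral.integral_mono_on ht (Continuous.intervalIntegrable (by fun_prop) _ _)
      (Continuous.intervalIntegrable (by fun_prop) _ _)
      fun u _ => by linarith [exp_pos (-θ * u)]
  simpa using h

theorem integral_one_sub_exp_neg_mul_le_mul_sq {θ t : ℝ} (hθ : 0 ≤ θ) (ht : 0 ≤ t) :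
    ∫ u in (0 : ℝ)..t, (1 - exp (-θ * u)) ≤ θ * t ^ 2 := by
  have h : ∫ u in (0 : ℝ)..t, (1 - exp (-θ * u)) ≤ ∫ _ in (0 : ℝ)..t, θ * t :=
    intervalIntegral.integral_mono_on ht (Continuous.intervalIntegrable (by fun_prop) _ _)
      (Continuous.intervalIntegrable (by fun_prop) _ _)
      fun u hu => by
        linarith [add_one_le_exp (-θ * u), mul_le_mul_of_nonneg_left hu.2 hθ]
  refine h.trans_eq ?_
  rw [intervalIntegral.integral_const, smul_eq_mul]
  ring

theorem measure_Iio_neg_lt_top {Λ : Measure ℝ}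
    (hint : ∫⁻ x, ENNReal.ofReal (min 1 (x ^ 2)) ∂Λ < ⊤) {u : ℝ} (hu : 0 < u) :
    Λ (Iio (-u)) < ⊤ := by
  have hpos : 0 < min 1 (u ^ 2) := by positivity
  refine (measure_mono fun x hx => ?_).trans_lt
    ((meas_ge_le_lintegral_div (μ := Λ) (f := fun x => ENNReal.ofReal (min 1 (x ^ 2)))
      (by fun_prop) (ENNReal.ofReal_pos.2 hpos).ne' ENNReal.ofReal_ne_top).trans_lt
      (ENNReal.div_lt_top hint.ne (ENNReal.ofReal_pos.2 hpos).ne'))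
  have hx : x < -u := hx
  exact ENNReal.ofReal_le_ofReal (min_le_min_left _ (by nlinarith))

theorem ae_neg_of_measure_Ici_zero {Λ : Measure ℝ} (hcarrier : Λ (Ici 0) = 0) :
    ∀ᵐ x ∂Λ, x < 0 := by
  rw [ae_iff]
  simp only [not_lt]
  exact hcarrier

theorem lintegral_integral_one_sub_exp_lt_top {Λ : Measure ℝ} (hcarrier : Λ (Ici 0) = 0)
    (hint : ∫⁻ x, ENNReal.ofReal (min 1 (x ^ 2)) ∂Λ < ⊤)
    (hint1 : ∫⁻ x in Iic (-1 : ℝ), ENNReal.ofReal |x| ∂Λ < ⊤) {θ : ℝ} (hθ : 0 ≤ θ) :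
    ∫⁻ x, ENNReal.ofReal (∫ u in (0 : ℝ)..(-x), (1 - exp (-θ * u))) ∂Λ < ⊤ := by
  have hneg := ae_neg_of_measure_Ici_zero hcarrier
  have hbound : ∀ᵐ x ∂Λ, ENNReal.ofReal (∫ u in (0 : ℝ)..(-x), (1 - exp (-θ * u))) ≤
      ENNReal.ofReal θ * ENNReal.ofReal (min 1 (x ^ 2)) +
        (Iic (-1 : ℝ)).indicator (fun x => ENNReal.ofReal |x|) x := by
    filter_upwards [hneg] with x hx
    have hx' : 0 ≤ -x := by linarith
    by_cases h1 : x ≤ -1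
    · rw [indicator_of_mem (mem_Iic.2 h1), abs_of_neg hx]
      exact (ENNReal.ofReal_le_ofReal (integral_one_sub_exp_neg_mul_le_self hx')).trans
        le_add_self
    · rw [indicator_of_notMem (by simpa using h1), add_zero, ← ENNReal.ofReal_mul hθ,
        min_eq_right (by nlinarith)]
      refine ENNReal.ofReal_le_ofReal ?_
      simpa using integral_one_sub_exp_neg_mul_le_mul_sq hθ hx'
  refine (lintegral_mono_ae hbound).trans_lt ?_
  rw [lintegral_add_left (by fun_prop), lintegral_const_mul _ (by fun_prop),
    lintegral_indicator measurableSet_Iic]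
  exact ENNReal.add_lt_top.2 ⟨ENNReal.mul_lt_top ENNReal.ofReal_lt_top hint, hint1⟩

theorem lintegral_integral_one_sub_exp_eq_lintegral_tail {Λ : Measure ℝ}
    (hcarrier : Λ (Ici 0) = 0) (hint : ∫⁻ x, ENNReal.ofReal (min 1 (x ^ 2)) ∂Λ < ⊤)
    {θ : ℝ} (hθ : 0 ≤ θ) :
    ∫⁻ x, ENNReal.ofReal (∫ u in (0 : ℝ)..(-x), (1 - exp (-θ * u))) ∂Λ =
      ∫⁻ u in Ioi (0 : ℝ), ENNReal.ofReal ((1 - exp (-θ * u)) * (Λ (Iio (-u))).toReal) := by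
  have hnonneg : 0 ≤ᵐ[Λ] fun x => -x :=
    (ae_neg_of_measure_Ici_zero hcarrier).mono fun x hx => neg_nonneg.2 hx.le
  rw [lintegral_comp_eq_lintegral_meas_lt_mul Λ hnonneg (by fun_prop)
    (fun t _ => Continuous.intervalIntegrable (by fun_prop) _ _)
    ((ae_restrict_mem measurableSet_Ioi).mono fun u hu =>
      one_sub_exp_neg_mul_nonneg hθ (mem_Ioi.1 hu).le)]
  refine setLIntegral_congr_fun measurableSet_Ioi fun u hu => ?_
  have hset : {x : ℝ | u < -x} = Iio (-u) := by
    ext x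
    exact lt_neg (a := u)
  simp only [hset]
  rw [ENNReal.ofReal_mul (one_sub_exp_neg_mul_nonneg hθ (mem_Ioi.1 hu).le),
    ENNReal.ofReal_toReal (measure_Iio_neg_lt_top hint hu).ne, mul_comm]

theorem measurable_measure_Iio_neg (Λ : Measure ℝ) : Measurable fun u : ℝ => Λ (Iio (-u)) :=
  Antitone.measurable fun _ _ h => measure_mono (Iio_subset_Iio (neg_le_neg h))

theorem aestronglyMeasurable_one_sub_exp_mul_tail (Λ : Measure ℝ) (ν : Measure ℝ) (θ : ℝ) :
    AEStronglyMeasurable (fun u => (1 - exp (-θ * u)) * (Λ (Iio (-u))).toReal) ν :=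
  (Measurable.mul (by fun_prop) (measurable_measure_Iio_neg Λ).ennreal_toReal).aestronglyMeasurable

theorem ae_one_sub_exp_mul_tail_nonneg (Λ : Measure ℝ) {θ : ℝ} (hθ : 0 ≤ θ) :
    0 ≤ᵐ[volume.restrict (Ioi (0 : ℝ))]
      fun u => (1 - exp (-θ * u)) * (Λ (Iio (-u))).toReal :=
  (ae_restrict_mem measurableSet_Ioi).mono fun _ hu =>
    mul_nonneg (one_sub_exp_neg_mul_nonneg hθ (mem_Ioi.1 hu).le) ENNReal.toReal_nonneg

theorem continuous_integral_one_sub_exp_neg_mul (θ : ℝ) :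
    Continuous fun x : ℝ => ∫ u in (0 : ℝ)..(-x), (1 - exp (-θ * u)) :=
  (intervalIntegral.continuous_primitive
    (fun _ _ => Continuous.intervalIntegrable (by fun_prop) _ _) 0).comp continuous_neg

open MeasureTheory Real Set Filter

/-- Spatial Wiener–Hopf factorization `ψ(θ) = θ · φ(θ)` where
`φ(θ) = κ + (σ²/2)θ + ∫₀^∞ (1 − e^{−θu}) Λ((−∞,−u)) du`, with
`κ = −μ + ∫_{(−∞,−1]} x Λ(dx)`; in particular the integral defining `φ` is finite. -/
theorem levy_khintchine_wiener_hopf_factorization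
    (μ σ : ℝ) (Λ : Measure ℝ)
    (hcarrier : Λ (Set.Ici 0) = 0)
    (hint : ∫⁻ x, ENNReal.ofReal (min 1 (x ^ 2)) ∂Λ < ⊤)
    (hint1 : ∫⁻ x in Set.Iic (-1 : ℝ), ENNReal.ofReal |x| ∂Λ < ⊤) :
    (∀ θ : ℝ, 0 ≤ θ →
      IntegrableOn
        (fun u => (1 - Real.exp (-θ * u)) * (Λ (Set.Iio (-u))).toReal)
        (Set.Ioi 0) volume) ∧
    (∀ θ : ℝ, 0 ≤ θ →
      (-μ * θ + σ ^ 2 / 2 * θ ^ 2 +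
        ∫ x in Set.Iio 0,
          (Real.exp (θ * x) - 1 -
            θ * x * Set.indicator (Set.Ioo (-1 : ℝ) 0) (fun _ => (1 : ℝ)) x) ∂Λ)
      = θ * ((-μ + ∫ x in Set.Iic (-1 : ℝ), x ∂Λ) + σ ^ 2 / 2 * θ +
          ∫ u in Set.Ioi (0 : ℝ), (1 - Real.exp (-θ * u)) * (Λ (Set.Iio (-u))).toReal)) := by
  have hneg := ae_neg_of_measure_Ici_zero hcarrier
  refine ⟨fun θ hθ => ?_, fun θ hθ => ?_⟩
  · refine ⟨aestronglyMeasurable_one_sub_exp_mul_tail Λ _ θ, ?_⟩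
    rw [hasFiniteIntegral_iff_ofReal (ae_one_sub_exp_mul_tail_nonneg Λ hθ),
      ← lintegral_integral_one_sub_exp_eq_lintegral_tail hcarrier hint hθ]
    exact lintegral_integral_one_sub_exp_lt_top hcarrier hint hint1 hθ
  · have hnonneg : 0 ≤ᵐ[Λ] fun x => ∫ u in (0 : ℝ)..(-x), (1 - exp (-θ * u)) :=
      hneg.mono fun x hx => integral_one_sub_exp_neg_mul_nonneg hθ (by linarith)
    have hmeas : AEStronglyMeasurable
        (fun x => ∫ u in (0 : ℝ)..(-x), (1 - exp (-θ * u))) Λ :=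
      (continuous_integral_one_sub_exp_neg_mul θ).aestronglyMeasurable
    have hprim : Integrable (fun x => ∫ u in (0 : ℝ)..(-x), (1 - exp (-θ * u))) Λ :=
      ⟨hmeas, (hasFiniteIntegral_iff_ofReal hnonneg).2
        (lintegral_integral_one_sub_exp_lt_top hcarrier hint hint1 hθ)⟩
    have htail : ∫ u in Ioi (0 : ℝ), (1 - exp (-θ * u)) * (Λ (Iio (-u))).toReal =
        ∫ x, (∫ u in (0 : ℝ)..(-x), (1 - exp (-θ * u))) ∂Λ := by
      rw [integral_eq_lintegral_of_nonneg_ae (ae_one_sub_exp_mul_tail_nonneg Λ hθ)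
          (aestronglyMeasurable_one_sub_exp_mul_tail Λ _ θ),
        integral_eq_lintegral_of_nonneg_ae hnonneg hmeas,
        lintegral_integral_one_sub_exp_eq_lintegral_tail hcarrier hint hθ]
    have hlarge : IntegrableOn (fun x : ℝ => x) (Iic (-1)) Λ := by
      refine ⟨by fun_prop, (hasFiniteIntegral_iff_norm _).2 ?_⟩
      simpa only [norm_eq_abs] using hint1
    have hsplit : ∀ᵐ x ∂Λ,
        exp (θ * x) - 1 - θ * x * (Ioo (-1 : ℝ) 0).indicator (fun _ => (1 : ℝ)) x =
          θ * (∫ u in (0 : ℝ)..(-x), (1 - exp (-θ * u))) +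
            θ * (Iic (-1 : ℝ)).indicator (fun x => x) x := by
      filter_upwards [hneg] with x hx
      rw [integral_one_sub_exp_neg_mul, neg_mul_neg]
      by_cases h1 : x ≤ -1
      · rw [indicator_of_mem (mem_Iic.2 h1), indicator_of_notMem fun h => h.1.not_ge h1]
        ring
      · rw [indicator_of_notMem (s := Iic (-1 : ℝ)) h1,
          indicator_of_mem (s := Ioo (-1 : ℝ) 0) ⟨not_le.1 h1, hx⟩]
        ring
    rw [Measure.restrict_eq_self_of_ae_mem (s := Iio 0) hneg, integral_congr_ae hsplit,
      integral_add (hprim.const_mul θ)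
        ((hlarge.integrable_indicator measurableSet_Iic).const_mul θ),
      integral_const_mul, integral_const_mul, integral_indicator measurableSet_Iic, htail]
    ring
end

section
/- For every integer k ≥ 0 and every x ≥ 0, the iterated convolution satisfies W^{*(k+1)}(x) ≤ (x^k / k!) · W(x)^{k+1}. -/
open MeasureTheory Real Set

/-- `iterConv W k` is the `(k+1)`-fold convolution `W^{*(k+1)}`:
`W^{*1} = W` and `W^{*(k+1)}(x) = ∫₀^x W^{*k}(x−y) W(y) dy` for `x ≥ 0`,
with `W^{*(k+1)}(x) = 0` for `x < 0`. -/
noncomputable def iterConv (W : ℝ → ℝ) : ℕ → ℝ → ℝ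
  | 0 => W
  | (k + 1) => fun x => if x < 0 then 0 else ∫ y in (0 : ℝ)..x, iterConv W k (x - y) * W y

theorem iterConv_nonneg {W : ℝ → ℝ} (hW0 : ∀ x, 0 ≤ W x) (k : ℕ) (x : ℝ) :
    0 ≤ iterConv W k x := by
  induction k generalizing x with
  | zero => exact hW0 x
  | succ k ih =>
    simp only [iterConv]
    split_ifs with h
    · exact le_rfl
    · exact intervalIntegral.integral_nonneg (not_lt.mp h) fun y _ => mul_nonneg (ih _) (hW0 y)

/-- For every integer `k ≥ 0` and every `x ≥ 0`, the iterated convolution satisfies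
`W^{*(k+1)}(x) ≤ (x^k / k!) · W(x)^{k+1}`. -/
theorem iterConv_le (W : ℝ → ℝ)
    (hW0 : ∀ x, 0 ≤ W x) (hmono : Monotone W) (hneg : ∀ x < 0, W x = 0)
    (k : ℕ) (x : ℝ) (hx : 0 ≤ x) :
    iterConv W k x ≤ x ^ k / (Nat.factorial k) * (W x) ^ (k + 1) := by
  induction k generalizing x with
  | zero => simp [iterConv]
  | succ k ih =>
    simp only [iterConv, if_neg (not_lt.mpr hx)]
    have hbound : ∀ y ∈ Ioc 0 x, iterConv W k (x - y) * W y ≤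
        (x - y) ^ k * (W x ^ (k + 2) / Nat.factorial k) := by
      rintro y ⟨hy0, hyx⟩
      have hxy : 0 ≤ x - y := sub_nonneg.mpr hyx
      have hWxy : W (x - y) ≤ W x := hmono (by linarith)
      calc iterConv W k (x - y) * W y
          ≤ ((x - y) ^ k / Nat.factorial k * W (x - y) ^ (k + 1)) * W y :=
            mul_le_mul_of_nonneg_right (ih _ hxy) (hW0 y)
        _ ≤ ((x - y) ^ k / Nat.factorial k * W x ^ (k + 1)) * W x := by
            have := hW0 (x - y)
            have := hW0 x
            have := hW0 y
            have := hmono hyx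
            gcongr
        _ = (x - y) ^ k * (W x ^ (k + 2) / Nat.factorial k) := by ring
    have hint : IntervalIntegrable
        (fun y => (x - y) ^ k * (W x ^ (k + 2) / Nat.factorial k)) volume 0 x :=
      Continuous.intervalIntegrable (by fun_prop) 0 x
    calc ∫ y in (0 : ℝ)..x, iterConv W k (x - y) * W y
        ≤ ∫ y in (0 : ℝ)..x, (x - y) ^ k * (W x ^ (k + 2) / Nat.factorial k) := by
          rw [intervalIntegral.integral_of_le hx, intervalIntegral.integral_of_le hx]
          exact integral_mono_of_nonneg
            (ae_of_all _ fun y => mul_nonneg (iterConv_nonneg hW0 k _) (hW0 y)) hint.1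
            (ae_restrict_of_forall_mem measurableSet_Ioc hbound)
      _ = x ^ (k + 1) / Nat.factorial (k + 1) * W x ^ (k + 1 + 1) := by
          rw [intervalIntegral.integral_mul_const,
            intervalIntegral.integral_comp_sub_left (fun y => y ^ k) x, sub_self, sub_zero,
            integral_pow, Nat.factorial_succ]
          push_cast
          field_simp
          ring
end

section
/- Let P, Q ∈ ℂ[X] be polynomials with H := P′Q − PQ′ ≠ 0, and let N = deg P, M = deg Q. Then the set of q ∈ ℂ for which the equation P(z) = q·Q(z) has a solution z with Q(z) ≠ 0 of multiplicity greater than one (equivalently, there exists z with Q(z) ≠ 0, P(z) = q·Q(z) and H(z) = 0) is finite and has at most M + N − 1 elements. -/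
open Polynomial

/-- Let `P, Q ∈ ℂ[X]` with `H := P′Q − PQ′ ≠ 0`, `N = deg P`, `M = deg Q`.  Then the set of
`q ∈ ℂ` for which the equation `P(z) = q·Q(z)` has a solution `z` with `Q(z) ≠ 0` of
multiplicity greater than one (i.e. there exists `z` with `Q(z) ≠ 0`, `P(z) = q·Q(z)` and
`H(z) = 0`) is finite and has at most `M + N − 1` elements. -/
theorem multiple_root_values_finite (P Q : Polynomial ℂ)
    (hH : P.derivative * Q - P * Q.derivative ≠ 0) :
    {q : ℂ | ∃ z : ℂ, Q.eval z ≠ 0 ∧ P.eval z = q * Q.eval z ∧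
        (P.derivative * Q - P * Q.derivative).eval z = 0}.Finite ∧
    {q : ℂ | ∃ z : ℂ, Q.eval z ≠ 0 ∧ P.eval z = q * Q.eval z ∧
        (P.derivative * Q - P * Q.derivative).eval z = 0}.ncard
      ≤ Q.natDegree + P.natDegree - 1 := by
  classical
  set H := P.derivative * Q - P * Q.derivative with hHdef
  have hw : H = wronskian Q P := by rw [hHdef, wronskian]; ring
  have hdeg : H.natDegree < Q.natDegree + P.natDegree := by
    rw [hw]
    exact natDegree_wronskian_lt_add (hw ▸ hH)
  have hsub : {q : ℂ | ∃ z : ℂ, Q.eval z ≠ 0 ∧ P.eval z = q * Q.eval z ∧ H.eval z = 0} ⊆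
      (H.roots.toFinset.image fun z => P.eval z / Q.eval z : Finset ℂ) := by
    rintro q ⟨z, hQ, hP, hz⟩
    rw [Finset.mem_coe, Finset.mem_image]
    exact ⟨z, Multiset.mem_toFinset.2 ((mem_roots hH).2 hz), by rw [hP, mul_div_cancel_right₀ q hQ]⟩
  refine ⟨(Finset.finite_toSet _).subset hsub, ?_⟩
  calc _ ≤ _ := Set.ncard_le_ncard hsub (Finset.finite_toSet _)
    _ = (H.roots.toFinset.image fun z => P.eval z / Q.eval z).card := Set.ncard_coe_finset _
    _ ≤ H.roots.toFinset.card := Finset.card_image_le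
    _ ≤ H.roots.card := Multiset.toFinset_card_le _
    _ ≤ H.natDegree := card_roots' H
    _ ≤ Q.natDegree + P.natDegree - 1 := Nat.le_sub_one_of_lt hdeg
end

section
/- Let c > 0, let a, b ≥ 0, and let ξ be a measure on (0,∞) with ∫_{(0,∞)} (1 ∧ t) ξ(dt) < ∞, with not all of a, b, ξ zero (a > 0 or b > 0 or ξ((0,∞)) > 0). Define F(x) = e^{cx}·(a + bx + ∫_{(0,∞)} (1 − e^{−xt}) ξ(dt)) for x ≥ 0. Then F is three times differentiable on (0,∞) with F‴(x) > 0 for every x > 0; in particular the first derivative F′ is strictly convex on (0,∞). -/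
open MeasureTheory Real Set

/-- On `(0,∞)`, the kernel `tⁿ⁺¹ e^{-yt}` is dominated by a multiple of `min 1 t`. -/
lemma pow_succ_mul_exp_neg_mul_le {y t : ℝ} (hy : 0 < y) (ht : 0 < t) (n : ℕ) :
    t ^ (n + 1) * exp (-y * t) ≤
      ((n + 1).factorial / y ^ (n + 1) + n.factorial / y ^ n) * min 1 t := by
  have key (k : ℕ) : t ^ k * exp (-y * t) ≤ k.factorial / y ^ k := by
    have h := Real.pow_div_factorial_le_exp (y * t) (by positivity) k
    rw [div_le_iff₀ (by positivity), mul_pow] at h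
    rw [neg_mul, exp_neg, ← div_eq_mul_inv, div_le_div_iff₀ (exp_pos _) (by positivity)]
    linarith
  have hA : 0 ≤ ((n + 1).factorial : ℝ) / y ^ (n + 1) := by positivity
  have hB : 0 ≤ (n.factorial : ℝ) / y ^ n := by positivity
  rcases min_cases 1 t with ⟨h, -⟩ | ⟨h, -⟩ <;> rw [h]
  · linarith [key (n + 1)]
  · calc t ^ (n + 1) * exp (-y * t) = t ^ n * exp (-y * t) * t := by ring
      _ ≤ _ := by gcongr; linarith [key n]

lemma integrable_pow_succ_mul_exp_neg_mul {μ : Measure ℝ} (hpos : ∀ᵐ t ∂μ, 0 < t)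
    (hmin : Integrable (fun t => min 1 t) μ) {y : ℝ} (hy : 0 < y) (n : ℕ) :
    Integrable (fun t => t ^ (n + 1) * exp (-y * t)) μ := by
  refine (hmin.const_mul
    ((n + 1).factorial / y ^ (n + 1) + n.factorial / y ^ n)).mono'
    (by fun_prop) ?_
  filter_upwards [hpos] with t ht
  rw [norm_of_nonneg (by positivity)]
  exact pow_succ_mul_exp_neg_mul_le hy ht n

lemma integrable_one_sub_exp_neg_mul {μ : Measure ℝ} (hpos : ∀ᵐ t ∂μ, 0 < t)
    (hmin : Integrable (fun t => min 1 t) μ) {x : ℝ} (hx : 0 < x) :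
    Integrable (fun t => 1 - exp (-x * t)) μ := by
  refine (hmin.const_mul (1 + x)).mono' (by fun_prop) ?_
  filter_upwards [hpos] with t ht
  have hxt := mul_pos hx ht
  have h1 : exp (-x * t) ≤ 1 := exp_le_one_iff.2 (by linarith)
  have h2 := add_one_le_exp (-x * t)
  rw [norm_of_nonneg (by linarith)]
  rcases min_cases 1 t with ⟨h, -⟩ | ⟨h, -⟩ <;> rw [h] <;> linarith [exp_pos (-x * t)]

/-- Differentiation under the integral sign for a kernel whose `x`-derivative is, up to sign,
`tⁿ⁺¹ e^{-xt}`. -/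
lemma hasDerivAt_integral_of_deriv_pow_succ_mul_exp {μ : Measure ℝ} (hpos : ∀ᵐ t ∂μ, 0 < t)
    (hmin : Integrable (fun t => min 1 t) μ) (n : ℕ) {f f' : ℝ → ℝ → ℝ} {x : ℝ} (hx : 0 < x)
    (hf : ∀ y, Continuous (f y)) (hf' : ∀ y, Continuous (f' y)) (hint : Integrable (f x) μ)
    (hnorm : ∀ y t, 0 < t → ‖f' y t‖ = t ^ (n + 1) * exp (-y * t))
    (hderiv : ∀ y t, HasDerivAt (fun z => f z t) (f' y t) y) :
    HasDerivAt (fun y => ∫ t, f y t ∂μ) (∫ t, f' x t ∂μ) x := by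
  refine (hasDerivAt_integral_of_dominated_loc_of_deriv_le
    (bound := fun t => t ^ (n + 1) * exp (-(x / 2) * t))
    (Ioi_mem_nhds (half_lt_self hx)) ?_ hint ?_ ?_ ?_ ?_).2
  · exact .of_forall fun y => (hf y).aestronglyMeasurable
  · exact (hf' x).aestronglyMeasurable
  · filter_upwards [hpos] with t ht y hy
    rw [hnorm y t ht]
    have hy' : x / 2 ≤ y := le_of_lt hy
    gcongr
  · exact integrable_pow_succ_mul_exp_neg_mul hpos hmin (half_pos hx) n
  · exact .of_forall fun t y _ => hderiv y t

lemma hasDerivAt_exp_neg_mul (t y : ℝ) :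
    HasDerivAt (fun z => exp (-z * t)) (-(t * exp (-y * t))) y := by
  refine ((hasDerivAt_id' y).fun_neg.mul_const t).exp.congr_deriv ?_
  ring

lemma hasDerivAt_integral_one_sub_exp {μ : Measure ℝ} (hpos : ∀ᵐ t ∂μ, 0 < t)
    (hmin : Integrable (fun t => min 1 t) μ) {x : ℝ} (hx : 0 < x) :
    HasDerivAt (fun y => ∫ t, (1 - exp (-y * t)) ∂μ) (∫ t, t ^ 1 * exp (-x * t) ∂μ) x := by
  refine hasDerivAt_integral_of_deriv_pow_succ_mul_exp hpos hmin 0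
    (f' := fun y t => t ^ 1 * exp (-y * t)) hx
    (fun y => by fun_prop) (fun y => by fun_prop)
    (integrable_one_sub_exp_neg_mul hpos hmin hx) (fun y t ht => ?_) (fun y t => ?_)
  · exact norm_of_nonneg (by positivity)
  · simpa using (hasDerivAt_exp_neg_mul t y).const_sub 1

lemma hasDerivAt_integral_pow_succ_mul_exp {μ : Measure ℝ} (hpos : ∀ᵐ t ∂μ, 0 < t)
    (hmin : Integrable (fun t => min 1 t) μ) (n : ℕ) {x : ℝ} (hx : 0 < x) :
    HasDerivAt (fun y => ∫ t, t ^ (n + 1) * exp (-y * t) ∂μ)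
      (-∫ t, t ^ (n + 2) * exp (-x * t) ∂μ) x := by
  rw [← integral_neg]
  refine hasDerivAt_integral_of_deriv_pow_succ_mul_exp hpos hmin (n + 1)
    (f' := fun y t => -(t ^ (n + 2) * exp (-y * t))) hx
    (fun y => by fun_prop) (fun y => by fun_prop)
    (integrable_pow_succ_mul_exp_neg_mul hpos hmin hx n) (fun y t ht => ?_) (fun y t => ?_)
  · rw [norm_neg]
    exact norm_of_nonneg (by positivity)
  · refine ((hasDerivAt_exp_neg_mul t y).const_mul (t ^ (n + 1))).congr_deriv ?_
    ring

lemma hasDerivAt_exp_const_mul_mul {c x u' : ℝ} {u : ℝ → ℝ} (hu : HasDerivAt u u' x) :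
    HasDerivAt (fun y => exp (c * y) * u y) (exp (c * x) * (c * u x + u')) x := by
  refine (((hasDerivAt_id' x).const_mul c).exp.fun_mul hu).congr_deriv ?_
  ring

lemma deriv_deriv_deriv_pos_of_hasDerivAt {F F₁ F₂ F₃ : ℝ → ℝ}
    (h₁ : ∀ x > 0, HasDerivAt F (F₁ x) x) (h₂ : ∀ x > 0, HasDerivAt F₁ (F₂ x) x)
    (h₃ : ∀ x > 0, HasDerivAt F₂ (F₃ x) x) (hpos : ∀ x > 0, 0 < F₃ x) :
    (∀ x > (0 : ℝ), DifferentiableAt ℝ F x ∧ DifferentiableAt ℝ (deriv F) x ∧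
      DifferentiableAt ℝ (deriv (deriv F)) x ∧ 0 < deriv (deriv (deriv F)) x) ∧
    StrictConvexOn ℝ (Ioi 0) (deriv F) := by
  have lift {f g g' : ℝ → ℝ} (hf : ∀ x > 0, HasDerivAt f (g x) x)
      (hg : ∀ x > 0, HasDerivAt g (g' x) x) (x : ℝ) (hx : x > 0) :
      HasDerivAt (deriv f) (g' x) x :=
    (hg x hx).congr_of_eventuallyEq <| by
      filter_upwards [Ioi_mem_nhds hx] with y hy using (hf y hy).deriv
  have d₂ := lift h₁ h₂
  have d₃ := lift d₂ h₃
  have p (x : ℝ) (hx : x > 0) : 0 < deriv (deriv (deriv F)) x := by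
    rw [(d₃ x hx).deriv]; exact hpos x hx
  refine ⟨fun x hx => ⟨(h₁ x hx).differentiableAt, (d₂ x hx).differentiableAt,
    (d₃ x hx).differentiableAt, p x hx⟩, strictConvexOn_of_deriv2_pos (convex_Ioi 0)
    (fun x hx => (d₂ x hx).continuousAt.continuousWithinAt) fun x hx => ?_⟩
  rw [interior_Ioi] at hx
  exact p x hx

lemma cube_add_sub_cube_mul_exp_pos {c x t : ℝ} (hc : 0 < c) (hx : 0 < x) (ht : 0 < t) :
    0 < c ^ 3 + (t - c) ^ 3 * exp (-x * t) := by
  have h1 : exp (-x * t) ≤ 1 := exp_le_one_iff.2 (by nlinarith [mul_pos hx ht])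
  have h0 := exp_pos (-x * t)
  have h2 : (-c) ^ 3 < (t - c) ^ 3 := (Odd.strictMono_pow (by decide)) (by linarith)
  have h3 : 0 < c ^ 3 := by positivity
  nlinarith

/-- The value at `x` of `e^{-cx} (d/dx)³ ∫ (e^{cx} - e^{(c-t)x}) μ(dt)`, expanded by the Leibniz
rule, as a single integral. -/
lemma integral_cube_add_sub_cube_mul_exp {μ : Measure ℝ} (hpos : ∀ᵐ t ∂μ, 0 < t)
    (hmin : Integrable (fun t => min 1 t) μ) (c : ℝ) {x : ℝ} (hx : 0 < x) :
    Integrable (fun t => c ^ 3 + (t - c) ^ 3 * exp (-x * t)) μ ∧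
    ∫ t, (c ^ 3 + (t - c) ^ 3 * exp (-x * t)) ∂μ =
      c ^ 3 * ∫ t, (1 - exp (-x * t)) ∂μ + 3 * c ^ 2 * ∫ t, t ^ 1 * exp (-x * t) ∂μ
        - 3 * c * ∫ t, t ^ 2 * exp (-x * t) ∂μ + ∫ t, t ^ 3 * exp (-x * t) ∂μ := by
  have i0 := (integrable_one_sub_exp_neg_mul hpos hmin hx).const_mul (c ^ 3)
  have i1 := (integrable_pow_succ_mul_exp_neg_mul hpos hmin hx 0).const_mul (3 * c ^ 2)
  have i2 := (integrable_pow_succ_mul_exp_neg_mul hpos hmin hx 1).const_mul (3 * c)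
  have i3 := integrable_pow_succ_mul_exp_neg_mul hpos hmin hx 2
  have e : (fun t => c ^ 3 + (t - c) ^ 3 * exp (-x * t)) = fun t =>
      c ^ 3 * (1 - exp (-x * t)) + 3 * c ^ 2 * (t ^ (0 + 1) * exp (-x * t))
        - 3 * c * (t ^ (1 + 1) * exp (-x * t)) + t ^ (2 + 1) * exp (-x * t) := by
    ext t; ring
  rw [e]
  refine ⟨((i0.fun_add i1).sub' i2).fun_add i3, ?_⟩
  rw [integral_add ((i0.fun_add i1).sub' i2) i3, integral_sub (i0.fun_add i1) i2, integral_add i0 i1,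
    integral_const_mul, integral_const_mul, integral_const_mul]

/-- Let `c > 0`, `a, b ≥ 0`, and let `ξ` be a measure on `(0,∞)` with
`∫ (1 ∧ t) ξ(dt) < ∞`, not all of `a, b, ξ` zero.  Define
`F(x) = e^{cx}·(a + bx + ∫ (1 − e^{−xt}) ξ(dt))`.  Then `F` is three times
differentiable on `(0,∞)` with `F‴(x) > 0` for every `x > 0`; in particular `F′` is
strictly convex on `(0,∞)`. -/
theorem bernstein_tilted_third_deriv_pos
    (c a b : ℝ) (hc : 0 < c) (ha : 0 ≤ a) (hb : 0 ≤ b)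
    (ξ : Measure ℝ) (hcarrier : ξ (Set.Iic 0) = 0)
    (hint : ∫⁻ t, ENNReal.ofReal (min 1 t) ∂ξ < ⊤)
    (hnz : 0 < a ∨ 0 < b ∨ 0 < ξ (Set.Ioi 0)) :
    (∀ x > (0 : ℝ),
      DifferentiableAt ℝ
        (fun x : ℝ => Real.exp (c * x) *
          (a + b * x + ∫ t in Set.Ioi (0 : ℝ), (1 - Real.exp (-x * t)) ∂ξ)) x ∧
      DifferentiableAt ℝ
        (deriv (fun x : ℝ => Real.exp (c * x) *
          (a + b * x + ∫ t in Set.Ioi (0 : ℝ), (1 - Real.exp (-x * t)) ∂ξ))) x ∧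
      DifferentiableAt ℝ
        (deriv (deriv (fun x : ℝ => Real.exp (c * x) *
          (a + b * x + ∫ t in Set.Ioi (0 : ℝ), (1 - Real.exp (-x * t)) ∂ξ)))) x ∧
      0 < deriv (deriv (deriv (fun x : ℝ => Real.exp (c * x) *
          (a + b * x + ∫ t in Set.Ioi (0 : ℝ), (1 - Real.exp (-x * t)) ∂ξ)))) x) ∧
    StrictConvexOn ℝ (Set.Ioi 0)
      (deriv (fun x : ℝ => Real.exp (c * x) *
        (a + b * x + ∫ t in Set.Ioi (0 : ℝ), (1 - Real.exp (-x * t)) ∂ξ))) := by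
  set μ := ξ.restrict (Ioi (0 : ℝ)) with hμ
  have hpos : ∀ᵐ t ∂μ, 0 < t := ae_restrict_mem measurableSet_Ioi
  have hmin : Integrable (fun t => min 1 t) μ := by
    refine ⟨by fun_prop, ?_⟩
    rw [hasFiniteIntegral_iff_ofReal (by
      filter_upwards [hpos] with t ht using le_min zero_le_one ht.le)]
    exact (lintegral_mono' Measure.restrict_le_self le_rfl).trans_lt hint
  have hφ₀ (x : ℝ) (hx : x > 0) :
      HasDerivAt (fun y => a + b * y + ∫ t, (1 - exp (-y * t)) ∂μ)
        (b + ∫ t, t ^ 1 * exp (-x * t) ∂μ) x := by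
    simpa using (((hasDerivAt_id x).const_mul b).const_add a).fun_add
      (hasDerivAt_integral_one_sub_exp hpos hmin hx)
  have hφ₁ (x : ℝ) (hx : x > 0) :
      HasDerivAt (fun y => b + ∫ t, t ^ 1 * exp (-y * t) ∂μ)
        (-∫ t, t ^ 2 * exp (-x * t) ∂μ) x :=
    (hasDerivAt_integral_pow_succ_mul_exp hpos hmin 0 hx).const_add b
  have hφ₂ (x : ℝ) (hx : x > 0) :
      HasDerivAt (fun y => -∫ t, t ^ 2 * exp (-y * t) ∂μ)
        (∫ t, t ^ 3 * exp (-x * t) ∂μ) x := by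
    simpa using (hasDerivAt_integral_pow_succ_mul_exp hpos hmin 1 hx).fun_neg
  have hψ₁ (x : ℝ) (hx : x > 0) := ((hφ₀ x hx).const_mul c).fun_add (hφ₁ x hx)
  have hψ₂ (x : ℝ) (hx : x > 0) := ((hψ₁ x hx).const_mul c).fun_add
    (((hφ₁ x hx).const_mul c).fun_add (hφ₂ x hx))
  refine deriv_deriv_deriv_pos_of_hasDerivAt
    (fun x hx => hasDerivAt_exp_const_mul_mul (hφ₀ x hx))
    (fun x hx => hasDerivAt_exp_const_mul_mul (hψ₁ x hx))
    (fun x hx => hasDerivAt_exp_const_mul_mul (hψ₂ x hx)) fun x hx => mul_pos (exp_pos _) ?_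
  obtain ⟨hI, hIeq⟩ := integral_cube_add_sub_cube_mul_exp hpos hmin c hx
  have hpt : ∀ᵐ t ∂μ, 0 < c ^ 3 + (t - c) ^ 3 * exp (-x * t) := by
    filter_upwards [hpos] with t ht using cube_add_sub_cube_mul_exp_pos hc hx ht
  have hI0 := integral_nonneg_of_ae (hpt.mono fun t ht => ht.le)
  have hsum : 0 < c ^ 3 * a + (c ^ 3 * x + 3 * c ^ 2) * b +
      ∫ t, (c ^ 3 + (t - c) ^ 3 * exp (-x * t)) ∂μ := by
    rcases hnz with h | h | h
    · positivity
    · positivity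
    · have : 0 < ∫ t, (c ^ 3 + (t - c) ^ 3 * exp (-x * t)) ∂μ := by
        rw [integral_pos_iff_support_of_nonneg_ae (hpt.mono fun t ht => ht.le) hI]
        have hsupp : Function.support (fun t => c ^ 3 + (t - c) ^ 3 * exp (-x * t)) =ᵐ[μ] univ :=
          Filter.eventuallyEq_univ.2 (hpt.mono fun t ht => ht.ne')
        rwa [measure_congr hsupp, hμ, Measure.restrict_apply_univ]
      positivity
  rw [hIeq] at hsum
  refine hsum.trans_eq ?_
  ring
end

section
/- Let f : ℝ → [0,∞) be measurable and identically zero on (−∞,0), let β ≥ 0 and θ > 0, and suppose L := ∫₀^∞ e^{−(θ+β)x} f(x) dx < ∞. Define g(x) = e^{−βx} f(x) + β·∫₀^x e^{−βy} f(y) dy for x ≥ 0. Then ∫₀^∞ e^{−θx} g(x) dx = ((θ + β)/θ)·L. -/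
open MeasureTheory Real Set

/-- Tail integral of the exponential density, scaled by a constant. -/
theorem integral_exp_indicator_Ioi_mul {θ : ℝ} (hθ : 0 < θ) {y : ℝ} (hy : 0 ≤ y) (c : ℝ) :
    ∫ x in Set.Ioi 0, (Set.Ioi y).indicator (fun x => Real.exp (-θ * x)) x * c
      = Real.exp (-θ * y) * c / θ := by
  rw [integral_mul_const, setIntegral_indicator measurableSet_Ioi,
    Set.inter_eq_right.2 (Set.Ioi_subset_Ioi hy), integral_exp_mul_Ioi (neg_neg_of_pos hθ)]
  field_simp

/-- The kernel `1_{y < x} e^{-θx} h(y)` is integrable on the quadrant `(0,∞)²` whenever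
`e^{-θy} h(y)` is integrable on `(0,∞)`. -/
theorem integrable_exp_indicator_mul {h : ℝ → ℝ} (hh : Measurable h) {θ : ℝ} (hθ : 0 < θ)
    (hi : IntegrableOn (fun y => Real.exp (-θ * y) * h y) (Set.Ioi 0)) :
    Integrable (fun p : ℝ × ℝ =>
      (Set.Ioi p.2).indicator (fun x => Real.exp (-θ * x)) p.1 * h p.2)
      ((volume.restrict (Set.Ioi 0)).prod (volume.restrict (Set.Ioi 0))) := by
  have hmeas : Measurable (fun p : ℝ × ℝ =>
      (Set.Ioi p.2).indicator (fun x => Real.exp (-θ * x)) p.1 * h p.2) := by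
    refine Measurable.mul ?_ (hh.comp measurable_snd)
    exact Measurable.indicator (f := fun p : ℝ × ℝ => Real.exp (-θ * p.1))
      (s := {p : ℝ × ℝ | p.2 < p.1}) (by fun_prop)
      (measurableSet_lt measurable_snd measurable_fst)
  rw [integrable_prod_iff' hmeas.aestronglyMeasurable]
  constructor
  · filter_upwards with y
    refine Integrable.mul_const ?_ _
    exact (integrableOn_exp_mul_Ioi (neg_neg_of_pos hθ) 0).indicator measurableSet_Ioi
  · refine (hi.norm.div_const θ).congr ?_
    filter_upwards [ae_restrict_mem measurableSet_Ioi] with y hy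
    have hnn (x : ℝ) : 0 ≤ (Set.Ioi y).indicator (fun x => Real.exp (-θ * x)) x :=
      Set.indicator_nonneg (fun _ _ => (Real.exp_pos _).le) x
    simp only [norm_mul, Real.norm_of_nonneg (hnn _), Real.norm_of_nonneg (Real.exp_pos _).le]
    exact (integral_exp_indicator_Ioi_mul hθ (le_of_lt hy) _).symm

/-- Integrating out `y` in the kernel `1_{y < x} e^{-θx} h(y)`. -/
theorem integral_exp_indicator_mul {h : ℝ → ℝ} (θ : ℝ) {x : ℝ} (hx : 0 ≤ x) :
    ∫ y in Set.Ioi 0, (Set.Ioi y).indicator (fun x => Real.exp (-θ * x)) x * h y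
      = Real.exp (-θ * x) * ∫ y in (0 : ℝ)..x, h y := by
  have heq (y : ℝ) : (Set.Ioi y).indicator (fun x => Real.exp (-θ * x)) x * h y
      = (Set.Iio x).indicator (fun y => Real.exp (-θ * x) * h y) y := by
    by_cases hxy : y < x <;> simp [Set.indicator, hxy]
  simp only [heq]
  rw [setIntegral_indicator measurableSet_Iio, Set.Ioi_inter_Iio, integral_const_mul,
    intervalIntegral.integral_of_le hx, integral_Ioc_eq_integral_Ioo]

/-- `e^{-θx} ∫₀ˣ h` is integrable on `(0,∞)` whenever `e^{-θy} h(y)` is. -/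
theorem integrableOn_exp_mul_primitive {h : ℝ → ℝ} (hh : Measurable h) {θ : ℝ} (hθ : 0 < θ)
    (hi : IntegrableOn (fun y => Real.exp (-θ * y) * h y) (Set.Ioi 0)) :
    IntegrableOn (fun x => Real.exp (-θ * x) * ∫ y in (0 : ℝ)..x, h y) (Set.Ioi 0) := by
  refine (integrable_exp_indicator_mul hh hθ hi).integral_prod_left.congr ?_
  filter_upwards [ae_restrict_mem measurableSet_Ioi] with x hx
  exact integral_exp_indicator_mul θ (le_of_lt hx)

/-- The Laplace transform of the primitive of `h` is that of `h` divided by `θ`. -/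
theorem integral_exp_mul_primitive {h : ℝ → ℝ} (hh : Measurable h) {θ : ℝ} (hθ : 0 < θ)
    (hi : IntegrableOn (fun y => Real.exp (-θ * y) * h y) (Set.Ioi 0)) :
    ∫ x in Set.Ioi (0 : ℝ), Real.exp (-θ * x) * ∫ y in (0 : ℝ)..x, h y
      = (∫ y in Set.Ioi (0 : ℝ), Real.exp (-θ * y) * h y) / θ := by
  rw [← integral_div, ← setIntegral_congr_fun measurableSet_Ioi
      (fun x hx => integral_exp_indicator_mul (h := h) θ (le_of_lt hx)),
    ← setIntegral_congr_fun measurableSet_Ioi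
      (fun y hy => integral_exp_indicator_Ioi_mul hθ (le_of_lt hy) (h y))]
  exact integral_integral_swap (integrable_exp_indicator_mul hh hθ hi)

/-- Let `f : ℝ → [0,∞)` be measurable and identically zero on `(−∞,0)`, let `β ≥ 0` and
`θ > 0`, and suppose `L := ∫₀^∞ e^{−(θ+β)x} f(x) dx < ∞`.  Define
`g(x) = e^{−βx} f(x) + β·∫₀^x e^{−βy} f(y) dy`.  Then
`∫₀^∞ e^{−θx} g(x) dx = ((θ + β)/θ)·L`. -/
theorem tilted_scale_function_laplace_transform
    (f : ℝ → ℝ) (hmeas : Measurable f) (hpos : ∀ x, 0 ≤ f x)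
    (hneg : ∀ x < (0 : ℝ), f x = 0)
    (β θ : ℝ) (hβ : 0 ≤ β) (hθ : 0 < θ)
    (hL : IntegrableOn (fun x => Real.exp (-(θ + β) * x) * f x) (Set.Ioi 0) volume) :
    ∫ x in Set.Ioi (0 : ℝ),
        Real.exp (-θ * x) *
          (Real.exp (-β * x) * f x + β * ∫ y in (0 : ℝ)..x, Real.exp (-β * y) * f y)
      = ((θ + β) / θ) * ∫ x in Set.Ioi (0 : ℝ), Real.exp (-(θ + β) * x) * f x := by
  have hexp (x : ℝ) : Real.exp (-(θ + β) * x) * f x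
      = Real.exp (-θ * x) * (Real.exp (-β * x) * f x) := by
    rw [← mul_assoc, ← Real.exp_add]
    ring_nf
  simp only [hexp] at hL ⊢
  have hh : Measurable fun x => Real.exp (-β * x) * f x := by fun_prop
  simp only [mul_add, mul_left_comm _ β]
  rw [integral_add hL ((integrableOn_exp_mul_primitive hh hθ hL).const_mul β),
    integral_const_mul, integral_exp_mul_primitive hh hθ hL]
  generalize ∫ x in Set.Ioi (0 : ℝ), Real.exp (-θ * x) * (Real.exp (-β * x) * f x) = L
  field_simp
end

section
/- Let ψ be the Lévy–Khintchine Laplace exponent associated with (μ, σ, Π) and let c ≥ 0. Then for every θ ≥ 0, ψ(θ + c) − ψ(c) = −μ_c·θ + (σ²/2)θ² + ∫_{(−∞,0)} (e^{θx} − 1 − θx·1_{−1<x<0}) e^{cx} Π(dx), where μ_c = μ − σ²c − ∫_{(−1,0)} x(e^{cx} − 1) Π(dx). In particular, the Esscher-tilted exponent ψ_c(θ) = ψ(θ+c) − ψ(c) is again a Lévy–Khintchine Laplace exponent, with the same Gaussian coefficient σ and Lévy measure e^{cx} Π(dx). -/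
open MeasureTheory Real Set

lemma abs_exp_sub_one_sub_le_sq_of_nonpos {u : ℝ} (hu : u ≤ 0) :
    |exp u - 1 - u| ≤ u ^ 2 := by
  have h₁ : u + 1 ≤ exp u := add_one_le_exp u
  have h₂ : -u + 1 ≤ exp (-u) := add_one_le_exp (-u)
  have h₃ : exp u * exp (-u) = 1 := by rw [← exp_add, add_neg_cancel, exp_zero]
  have h₄ : exp u * (1 - u) ≤ 1 := by
    nlinarith [mul_le_mul_of_nonneg_left h₂ (exp_pos u).le]
  rw [abs_of_nonneg (by linarith)]
  have h₅ : exp u * (1 - u) ≤ (1 + u + u ^ 2) * (1 - u) := by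
    have h₆ : 0 ≤ -u * u ^ 2 := mul_nonneg (by linarith) (sq_nonneg u)
    nlinarith
  linarith [le_of_mul_le_mul_right h₅ (by linarith : 0 < 1 - u)]

lemma abs_exp_sub_one_le_one_of_nonpos {u : ℝ} (hu : u ≤ 0) : |exp u - 1| ≤ 1 := by
  rw [abs_le]
  constructor <;> linarith [exp_pos u, exp_le_one_iff.mpr hu]

lemma abs_levyKhintchine_integrand_le {a x : ℝ} (ha : 0 ≤ a) (hx : x < 0) :
    |exp (a * x) - 1 - a * x * (Ioo (-1 : ℝ) 0).indicator (fun _ => (1 : ℝ)) x| ≤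
      (1 + a ^ 2) * min 1 (x ^ 2) := by
  have hax : a * x ≤ 0 := mul_nonpos_of_nonneg_of_nonpos ha hx.le
  by_cases h : x ∈ Ioo (-1 : ℝ) 0
  · have hsq : x ^ 2 ≤ 1 := by nlinarith [h.1, h.2]
    rw [indicator_of_mem h, mul_one, min_eq_right hsq]
    nlinarith [abs_exp_sub_one_sub_le_sq_of_nonpos hax, sq_nonneg x]
  · have hx1 : x ≤ -1 := by
      by_contra! h'
      exact h ⟨h', hx⟩
    rw [indicator_of_notMem h, mul_zero, sub_zero, min_eq_left (by nlinarith)]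
    nlinarith [abs_exp_sub_one_le_one_of_nonpos hax, sq_nonneg a]

lemma abs_mul_exp_sub_one_le {c x : ℝ} (hc : 0 ≤ c) (hx : x ∈ Ioo (-1 : ℝ) 0) :
    |x * (exp (c * x) - 1)| ≤ c * min 1 (x ^ 2) := by
  have hcx : c * x ≤ 0 := mul_nonpos_of_nonneg_of_nonpos hc hx.2.le
  have hsq : x ^ 2 ≤ 1 := by nlinarith [hx.1, hx.2]
  rw [min_eq_right hsq,
    abs_of_nonneg (mul_nonneg_of_nonpos_of_nonpos hx.2.le (by linarith [exp_le_one_iff.mpr hcx]))]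
  nlinarith [add_one_le_exp (c * x), hx.2]

lemma integrable_min_one_sq {Λ : Measure ℝ}
    (hint : ∫⁻ x, ENNReal.ofReal (min 1 (x ^ 2)) ∂Λ < ⊤) :
    Integrable (fun x : ℝ => min 1 (x ^ 2)) Λ :=
  (lintegral_ofReal_ne_top_iff_integrable (by fun_prop)
    (ae_of_all _ fun x => le_min zero_le_one (sq_nonneg x))).mp hint.ne

lemma integrableOn_levyKhintchine_integrand {Λ : Measure ℝ}
    (hint : ∫⁻ x, ENNReal.ofReal (min 1 (x ^ 2)) ∂Λ < ⊤) {a : ℝ} (ha : 0 ≤ a) :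
    IntegrableOn (fun x => exp (a * x) - 1 -
      a * x * (Ioo (-1 : ℝ) 0).indicator (fun _ => (1 : ℝ)) x) (Iio 0) Λ := by
  have hind : Measurable ((Ioo (-1 : ℝ) 0).indicator (fun _ => (1 : ℝ))) :=
    measurable_const.indicator measurableSet_Ioo
  refine ((integrable_min_one_sq hint).integrableOn.const_mul (1 + a ^ 2)).mono'
    (by fun_prop) ?_
  filter_upwards [ae_restrict_mem measurableSet_Iio] with x hx
  exact abs_levyKhintchine_integrand_le ha hx

lemma integrableOn_levyKhintchine_integrand_mul_exp {Λ : Measure ℝ}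
    (hint : ∫⁻ x, ENNReal.ofReal (min 1 (x ^ 2)) ∂Λ < ⊤) {a c : ℝ} (ha : 0 ≤ a) (hc : 0 ≤ c) :
    IntegrableOn (fun x => (exp (a * x) - 1 -
      a * x * (Ioo (-1 : ℝ) 0).indicator (fun _ => (1 : ℝ)) x) * exp (c * x)) (Iio 0) Λ := by
  refine (integrableOn_levyKhintchine_integrand hint ha).mul_bdd (c := 1) (by fun_prop) ?_
  filter_upwards [ae_restrict_mem measurableSet_Iio] with x hx
  rw [norm_eq_abs, abs_exp, exp_le_one_iff]
  exact mul_nonpos_of_nonneg_of_nonpos hc (le_of_lt hx)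

lemma integrableOn_mul_exp_sub_one {Λ : Measure ℝ}
    (hint : ∫⁻ x, ENNReal.ofReal (min 1 (x ^ 2)) ∂Λ < ⊤) {c : ℝ} (hc : 0 ≤ c) :
    IntegrableOn (fun x => x * (exp (c * x) - 1)) (Ioo (-1) 0) Λ := by
  refine ((integrable_min_one_sq hint).integrableOn.const_mul c).mono' (by fun_prop) ?_
  filter_upwards [ae_restrict_mem measurableSet_Ioo] with x hx
  exact abs_mul_exp_sub_one_le hc hx

lemma lintegral_withDensity_exp_le {Λ : Measure ℝ} (hcarrier : Λ (Ici 0) = 0) {c : ℝ}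
    (hc : 0 ≤ c) {f : ℝ → ENNReal} (hf : Measurable f) :
    ∫⁻ x, f x ∂(Λ.withDensity fun x => ENNReal.ofReal (exp (c * x))) ≤ ∫⁻ x, f x ∂Λ := by
  rw [lintegral_withDensity_eq_lintegral_mul Λ (by fun_prop) hf]
  refine lintegral_mono_ae ?_
  filter_upwards [measure_eq_zero_iff_ae_notMem.mp hcarrier] with x hx
  refine mul_le_of_le_one_left zero_le (ENNReal.ofReal_le_one.mpr (exp_le_one_iff.mpr ?_))
  exact mul_nonpos_of_nonneg_of_nonpos hc (le_of_not_ge hx)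

/-- The change of drift under Esscher tilting, at the level of the jump integrals. -/
lemma integral_levyKhintchine_add_sub {Λ : Measure ℝ}
    (hint : ∫⁻ x, ENNReal.ofReal (min 1 (x ^ 2)) ∂Λ < ⊤) {θ c : ℝ} (hθ : 0 ≤ θ) (hc : 0 ≤ c) :
    (∫ x in Iio 0, (exp ((θ + c) * x) - 1 -
        (θ + c) * x * (Ioo (-1 : ℝ) 0).indicator (fun _ => (1 : ℝ)) x) ∂Λ) -
      ∫ x in Iio 0, (exp (c * x) - 1 -
        c * x * (Ioo (-1 : ℝ) 0).indicator (fun _ => (1 : ℝ)) x) ∂Λ =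
    (∫ x in Iio 0, (exp (θ * x) - 1 -
        θ * x * (Ioo (-1 : ℝ) 0).indicator (fun _ => (1 : ℝ)) x) * exp (c * x) ∂Λ) +
      θ * ∫ x in Ioo (-1 : ℝ) 0, x * (exp (c * x) - 1) ∂Λ := by
  have hG := ((integrableOn_mul_exp_sub_one hint hc).integrable_indicator
    measurableSet_Ioo).integrableOn (s := Iio 0)
  have hset : ∫ x in Ioo (-1 : ℝ) 0, x * (exp (c * x) - 1) ∂Λ =
      ∫ x in Iio 0, (Ioo (-1 : ℝ) 0).indicator (fun x => x * (exp (c * x) - 1)) x ∂Λ := by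
    rw [setIntegral_indicator measurableSet_Ioo, inter_eq_right.mpr Ioo_subset_Iio_self]
  rw [hset, ← integral_const_mul,
    ← integral_sub (integrableOn_levyKhintchine_integrand hint (add_nonneg hθ hc))
      (integrableOn_levyKhintchine_integrand hint hc),
    ← integral_add (integrableOn_levyKhintchine_integrand_mul_exp hint hθ hc) (hG.const_mul θ)]
  congr 1 with x
  by_cases h : x ∈ Ioo (-1 : ℝ) 0
  · simp only [indicator_of_mem h, add_mul, exp_add]
    ring
  · simp only [indicator_of_notMem h, add_mul, exp_add]
    ring

/-- Esscher tilting: with `ψ` the Lévy–Khintchine exponent of `(μ, σ, Λ)` and `c ≥ 0`,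
for every `θ ≥ 0`,
`ψ(θ + c) − ψ(c) = −μ_c θ + (σ²/2)θ² + ∫_{(−∞,0)} (e^{θx} − 1 − θx·1_{(−1,0)}(x)) e^{cx} Λ(dx)`
where `μ_c = μ − σ²c − ∫_{(−1,0)} x(e^{cx} − 1) Λ(dx)`; in particular the tilted exponent
is again a Lévy–Khintchine Laplace exponent with Gaussian coefficient `σ` and Lévy measure
`e^{cx} Λ(dx)` (which is carried by `(−∞,0)` and integrates `1 ∧ x²`). -/
theorem esscher_tilted_exponent
    (μ σ : ℝ) (Λ : Measure ℝ)
    (hcarrier : Λ (Set.Ici 0) = 0)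
    (hint : ∫⁻ x, ENNReal.ofReal (min 1 (x ^ 2)) ∂Λ < ⊤)
    (c : ℝ) (hc : 0 ≤ c) :
    (Λ.withDensity (fun x => ENNReal.ofReal (Real.exp (c * x)))) (Set.Ici 0) = 0 ∧
    (∫⁻ x, ENNReal.ofReal (min 1 (x ^ 2))
      ∂(Λ.withDensity (fun x => ENNReal.ofReal (Real.exp (c * x))))) < ⊤ ∧
    (∀ θ : ℝ, 0 ≤ θ →
      ((-μ * (θ + c) + σ ^ 2 / 2 * (θ + c) ^ 2 +
          ∫ x in Set.Iio 0,
            (Real.exp ((θ + c) * x) - 1 -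
              (θ + c) * x * Set.indicator (Set.Ioo (-1 : ℝ) 0) (fun _ => (1 : ℝ)) x) ∂Λ) -
        (-μ * c + σ ^ 2 / 2 * c ^ 2 +
          ∫ x in Set.Iio 0,
            (Real.exp (c * x) - 1 -
              c * x * Set.indicator (Set.Ioo (-1 : ℝ) 0) (fun _ => (1 : ℝ)) x) ∂Λ))
      = -(μ - σ ^ 2 * c - ∫ x in Set.Ioo (-1 : ℝ) 0, x * (Real.exp (c * x) - 1) ∂Λ) * θ +
          σ ^ 2 / 2 * θ ^ 2 +
          ∫ x in Set.Iio 0,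
            (Real.exp (θ * x) - 1 -
              θ * x * Set.indicator (Set.Ioo (-1 : ℝ) 0) (fun _ => (1 : ℝ)) x) *
              Real.exp (c * x) ∂Λ) := by
  refine ⟨withDensity_absolutelyContinuous _ _ hcarrier,
    (lintegral_withDensity_exp_le hcarrier hc (by fun_prop)).trans_lt hint, fun θ hθ => ?_⟩
  linear_combination integral_levyKhintchine_add_sub hint hθ hc
end

section
/- For every integer M ≥ 1, the Gaver–Stehfest coefficients a_n = (−1)^{M+n} Σ_{j=⌊(n+1)/2⌋}^{min(n,M)} (j^{M+1}/M!)·C(M,j)·C(2j,j)·C(j, n−j), for 1 ≤ n ≤ 2M, satisfy Σ_{n=1}^{2M} a_n = 0 (as rational numbers). -/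
/-- The alternating sum of the binomial coefficients `C(j, n - j)` over `j ≤ n ≤ 2j` vanishes. -/
theorem sum_Icc_neg_one_pow_mul_choose_sub {j : ℕ} (hj : j ≠ 0) :
    ∑ n ∈ Finset.Icc j (2 * j), (-1 : ℚ) ^ n * (Nat.choose j (n - j) : ℚ) = 0 := by
  have h : ∑ i ∈ Finset.range (j + 1), (-1 : ℚ) ^ i * (Nat.choose j i : ℚ) = 0 := by
    exact_mod_cast Int.alternating_sum_range_choose_of_ne hj
  rw [← Finset.Ico_add_one_right_eq_Icc, Finset.sum_Ico_eq_sum_range,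
    show 2 * j + 1 - j = j + 1 by omega]
  simp only [Nat.add_sub_cancel_left, pow_add, mul_assoc]
  rw [← Finset.mul_sum, h, mul_zero]


/-- For every integer `M ≥ 1`, the Gaver–Stehfest coefficients
`a_n = (−1)^{M+n} Σ_{j=⌊(n+1)/2⌋}^{min(n,M)} (j^{M+1}/M!)·C(M,j)·C(2j,j)·C(j,n−j)`,
`1 ≤ n ≤ 2M`, satisfy `Σ_{n=1}^{2M} a_n = 0` (as rational numbers). -/
theorem gaver_stehfest_coefficients_sum_zero (M : ℕ) (hM : 1 ≤ M) :
    ∑ n ∈ Finset.Icc 1 (2 * M),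
        ((-1 : ℚ) ^ (M + n) *
          ∑ j ∈ Finset.Icc ((n + 1) / 2) (min n M),
            (j : ℚ) ^ (M + 1) / (Nat.factorial M : ℚ) *
              (Nat.choose M j : ℚ) * (Nat.choose (2 * j) j : ℚ) *
              (Nat.choose j (n - j) : ℚ))
      = 0 := by
  simp only [Finset.mul_sum]
  rw [Finset.sum_comm' (t' := Finset.Icc 1 M) (s' := fun j => Finset.Icc j (2 * j))
    (by intro n j; simp only [Finset.mem_Icc]; omega)]
  refine Finset.sum_eq_zero fun j hj => ?_
  have hj0 : j ≠ 0 := Nat.one_le_iff_ne_zero.mp (Finset.mem_Icc.mp hj).1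
  rw [← mul_zero ((-1 : ℚ) ^ M * ((j : ℚ) ^ (M + 1) / (Nat.factorial M : ℚ) *
    (Nat.choose M j : ℚ) * (Nat.choose (2 * j) j : ℚ))),
    ← sum_Icc_neg_one_pow_mul_choose_sub hj0, Finset.mul_sum]
  refine Finset.sum_congr rfl fun n _ => ?_
  ring
end
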